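/- Let n ≥ 11 with n ≡ 0 (mod 5) or n ≡ 3 (mod 5), and let f ∈ ℤ/nℤ. If S is a Type II set for P_f(n,2), then |S| ≥ ⌈3n/5⌉. -/

import Mathlib

namespace PetersenDom

/-- Vertex set of the generalized Petersen graph: `Sum.inl i` is the outer
vertex `u_i`, `Sum.inr i` is the inner vertex `v_i`, indices in `ZMod n`. -/
abbrev PVert (n : ℕ) := ZMod n ⊕ ZMod n

/-- The outer vertex `u_i`. -/
def uV {n : ℕ} (i : ZMod n) : PVert n := Sum.inl i

/-- The inner vertex `v_i`. -/
def vV {n : ℕ} (i : ZMod n) : PVert n := Sum.inr i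

/-- The generalized Petersen graph `P(n,2)`, with edges
`u_i u_{i+1}`, `u_i v_i`, `v_i v_{i+2}` (indices mod `n`). -/
def P2 (n : ℕ) : SimpleGraph (PVert n) :=
  SimpleGraph.fromRel (fun a b =>
    (∃ i : ZMod n, a = uV i ∧ b = uV (i + 1)) ∨
    (∃ i : ZMod n, a = uV i ∧ b = vV i) ∨
    (∃ i : ZMod n, a = vV i ∧ b = vV (i + 2)))

/-- `S` is a dominating set of `G`: every vertex is in `S` or adjacent to a vertex of `S`. -/
def IsDomSet {V : Type*} (G : SimpleGraph V) (S : Set V) : Prop :=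
  ∀ v : V, v ∈ S ∨ ∃ u ∈ S, G.Adj u v

/-- The domination number of `G`. -/
noncomputable def domNum {V : Type*} (G : SimpleGraph V) : ℕ :=
  sInf {k | ∃ S : Set V, IsDomSet G S ∧ S.ncard = k}

/-- `S` is a dominating set of `P_f(n,2) = P(n,2) - u_f`: it avoids `u_f`
and dominates every vertex other than `u_f`. -/
def IsDomSetF (n : ℕ) (f : ZMod n) (S : Set (PVert n)) : Prop :=
  uV f ∉ S ∧ ∀ v : PVert n, v ≠ uV f → v ∈ S ∨ ∃ u ∈ S, (P2 n).Adj u v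

/-- The domination number of `P_f(n,2)`. -/
noncomputable def domNumF (n : ℕ) (f : ZMod n) : ℕ :=
  sInf {k | ∃ S : Set (PVert n), IsDomSetF n f S ∧ S.ncard = k}

/-- `S` is a minimum dominating set of `P_f(n,2)`. -/
def MinDomF (n : ℕ) (f : ZMod n) (S : Set (PVert n)) : Prop :=
  IsDomSetF n f S ∧ S.ncard = domNumF n f

/-- The neighborhood `N(u_f) = {u_{f-1}, u_{f+1}, v_f}` of `u_f` in `P(n,2)`. -/
def Nbr (n : ℕ) (f : ZMod n) : Set (PVert n) := {uV (f - 1), uV (f + 1), vV f}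

/-- The block `B_i`: the 5 consecutive pairs of vertices centered at `u_i, v_i`. -/
def Blk (n : ℕ) (i : ZMod n) : Set (PVert n) :=
  {uV (i-2), uV (i-1), uV i, uV (i+1), uV (i+2),
   vV (i-2), vV (i-1), vV i, vV (i+1), vV (i+2)}

/-- `γ_i(S) = |B_i ∩ S|`. -/
noncomputable def gam (n : ℕ) (i : ZMod n) (S : Set (PVert n)) : ℕ :=
  (Blk n i ∩ S).ncard

/-- `L_i = {v_{i-1}, u_{i-2}, v_{i-2}}`. -/
def Lset (n : ℕ) (i : ZMod n) : Set (PVert n) := {vV (i-1), uV (i-2), vV (i-2)}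

/-- `R_i = {v_{i+1}, u_{i+2}, v_{i+2}}`. -/
def Rset (n : ℕ) (i : ZMod n) : Set (PVert n) := {vV (i+1), uV (i+2), vV (i+2)}

/-- `M_i = {u_{i-1}, v_i, u_{i+1}}`. -/
def Mset (n : ℕ) (i : ZMod n) : Set (PVert n) := {uV (i-1), vV i, uV (i+1)}

/-- `F = {f-2, f-1, f, f+1, f+2}`, the indices of the block `B_f`. -/
def Fset (n : ℕ) (f : ZMod n) : Set (ZMod n) := {f-2, f-1, f, f+1, f+2}

/-- A Type I set: a minimum dominating set `S` of `P_f(n,2)` with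
`γ_i(S) ≥ 2` for all `i`. -/
def TypeI (n : ℕ) (f : ZMod n) (S : Set (PVert n)) : Prop :=
  MinDomF n f S ∧ ∀ i : ZMod n, 2 ≤ gam n i S

/-- The couple number of `S`: the number of indices `i ∉ F` with `γ_i(S) = 2`. -/
noncomputable def coupleNum (n : ℕ) (f : ZMod n) (S : Set (PVert n)) : ℕ :=
  {i : ZMod n | gam n i S = 2 ∧ i ∉ Fset n f}.ncard

/-- A Type II set: a Type I set with `N(u_f) ∩ S = ∅`, `γ_f(S) = 3`, and
`B_f ∩ S = {u_{f-2}, v_{f+1}, v_{f+2}}`. -/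
def TypeII (n : ℕ) (f : ZMod n) (S : Set (PVert n)) : Prop :=
  TypeI n f S ∧ Nbr n f ∩ S = ∅ ∧ gam n f S = 3 ∧
    Blk n f ∩ S = {uV (f-2), vV (f+1), vV (f+2)}

/-- A Type III set: a Type I set with `N(u_f) ∩ S = ∅`, `γ_f(S) = 4`, and
`B_f ∩ S` one of four specified patterns. -/
def TypeIII (n : ℕ) (f : ZMod n) (S : Set (PVert n)) : Prop :=
  TypeI n f S ∧ Nbr n f ∩ S = ∅ ∧ gam n f S = 4 ∧
    (Blk n f ∩ S = {vV (f-1), vV (f+1), uV (f+2), vV (f+2)} ∨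
     Blk n f ∩ S = {uV (f-2), vV (f-2), uV (f+2), vV (f+2)} ∨
     Blk n f ∩ S = {vV (f-2), vV (f-1), vV (f+1), vV (f+2)} ∨
     Blk n f ∩ S = {uV (f-2), vV (f-2), vV (f+1), uV (f+2)})

/-- `⌈3n/5⌉`. -/
noncomputable def ceil35 (n : ℕ) : ℕ := ⌈(3 * (n : ℚ)) / 5⌉₊

/-- The bondage number of `G`: the least number of edges whose deletion
increases the domination number. -/
noncomputable def bondage {V : Type*} (G : SimpleGraph V) : ℕ :=
  sInf {k | ∃ E : Set (Sym2 V), E ⊆ G.edgeSet ∧ E.ncard = k ∧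
    domNum G < domNum (G.deleteEdges E)}

/-- The domination alteration number of `G`: the least number of vertices
whose removal changes the domination number. -/
noncomputable def alterNum {V : Type*} (G : SimpleGraph V) : ℕ :=
  sInf {k | ∃ A : Set V, A.ncard = k ∧ domNum (G.induce Aᶜ) ≠ domNum G}

end PetersenDom
namespace PetersenDom

/-- A potential on the local state of a set at a column. With `p` the previous column and `c` the
current one, `vppp` and `vpp` record membership of the inner vertices two and one columns before
`p`, and `up`, `vp`, `uc`, `vc` record membership of the vertices in the columns `p` and `c`. -/
def potential (vppp vpp up vp uc vc : Bool) : ℤ :=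
  let sel (inS dominated pending : ℤ) : ℤ :=
    if vp then inS else if up || vppp then dominated else pending
  match uc, vc, up, vpp with
  | true, true, _, _ => sel 7 6 2
  | true, false, _, _ => sel 4 1 0
  | false, true, _, _ => sel 2 2 0
  | false, false, true, true => sel 4 1 0
  | false, false, true, false => sel 3 (-2) 0
  | false, false, false, true => sel (-1) 1 0
  | false, false, false, false => sel (-1) (-2) (-5)

/-- Passing to the next column changes the potential by at most `5 w - 3`, where `w` is the number
of vertices chosen in the new column, if the inner vertex of the previous column and the outer
vertex of the current one are dominated. -/
theorem potential_step : ∀ vppp vpp up vp uc vc un vn : Bool,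
    (vp || up || vppp || vn) = true → (uc || vc || up || un) = true →
    potential vpp vp uc vc un vn - potential vppp vpp up vp uc vc ≤
      5 * ((un.toNat : ℤ) + vn.toNat) - 3 := by
  decide

theorem potential_empty_ge (vppp : Bool) : -5 ≤ potential vppp false false false false false := by
  cases vppp <;> decide

theorem IsDomSetF.inner {n : ℕ} {f : ZMod n} {S : Set (PVert n)} (h : IsDomSetF n f S)
    (i : ZMod n) : vV i ∈ S ∨ uV i ∈ S ∨ vV (i - 2) ∈ S ∨ vV (i + 2) ∈ S := by
  rcases h.2 (vV i) (by simp [uV, vV]) with h | ⟨w, hw, hadj⟩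
  · exact Or.inl h
  · simp only [P2, SimpleGraph.fromRel_adj] at hadj
    rcases hadj.2 with (⟨j, h₁, h₂⟩ | ⟨j, h₁, h₂⟩ | ⟨j, h₁, h₂⟩) |
      (⟨j, h₁, h₂⟩ | ⟨j, h₁, h₂⟩ | ⟨j, h₁, h₂⟩) <;>
      simp only [uV, vV, Sum.inr.injEq, reduceCtorEq] at h₁ h₂ <;> subst h₁ h₂ <;>
      simp_all [uV, vV]

theorem IsDomSetF.outer {n : ℕ} {f : ZMod n} {S : Set (PVert n)} (h : IsDomSetF n f S)
    {i : ZMod n} (hi : i ≠ f) :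
    uV i ∈ S ∨ vV i ∈ S ∨ uV (i - 1) ∈ S ∨ uV (i + 1) ∈ S := by
  rcases h.2 (uV i) (by simpa [uV] using hi) with h | ⟨w, hw, hadj⟩
  · exact Or.inl h
  · simp only [P2, SimpleGraph.fromRel_adj] at hadj
    rcases hadj.2 with (⟨j, h₁, h₂⟩ | ⟨j, h₁, h₂⟩ | ⟨j, h₁, h₂⟩) |
      (⟨j, h₁, h₂⟩ | ⟨j, h₁, h₂⟩ | ⟨j, h₁, h₂⟩) <;>
      simp only [uV, vV, Sum.inl.injEq, reduceCtorEq] at h₁ h₂ <;> subst h₁ h₂ <;>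
      simp_all [uV, vV]

open Classical in
theorem ncard_eq_sum_columns {n : ℕ} [NeZero n] (S : Set (PVert n)) :
    S.ncard = ∑ i : ZMod n, ((decide (uV i ∈ S)).toNat + (decide (vV i ∈ S)).toNat) := by
  rw [Set.ncard_eq_toFinset_card', ← Set.filter_mem_univ_eq_toFinset,
    Finset.card_filter, Fintype.sum_sum_type, Finset.sum_add_distrib]
  congr 1 <;> refine Finset.sum_congr rfl fun i _ => ?_ <;> split_ifs with h <;> simp [uV, vV, h]

theorem le_sum_of_nonneg_of_ne {ι : Type*} [Fintype ι] [DecidableEq ι] (g : ι → ℤ) (f : ι) {b : ℤ}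
    (hf : b ≤ g f) (hg : ∀ i ≠ f, 0 ≤ g i) : b ≤ ∑ i, g i := by
  rw [← Finset.add_sum_erase _ _ (Finset.mem_univ f)]
  have := Finset.sum_nonneg fun i (hi : i ∈ Finset.univ.erase f) => hg i (Finset.ne_of_mem_erase hi)
  linarith

/-- A Type II set satisfies `5 |S| ≥ 3 n - 3`, whatever the residue of `n` modulo 5. -/
theorem TypeII.three_mul_le {n : ℕ} (hn : 5 ≤ n) {f : ZMod n} {S : Set (PVert n)}
    (hS : TypeII n f S) : 3 * n ≤ 5 * S.ncard + 3 := by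
  classical
  have : NeZero n := ⟨by omega⟩
  obtain ⟨⟨⟨hdom, -⟩, -⟩, hN, -, hB⟩ := hS
  set u : ZMod n → Bool := fun i => decide (uV i ∈ S) with hu
  set v : ZMod n → Bool := fun i => decide (vV i ∈ S) with hv
  set P : ZMod n → ℤ := fun i =>
    potential (v (i - 3)) (v (i - 2)) (u (i - 1)) (v (i - 1)) (u i) (v i) with hP
  set w : ZMod n → ℕ := fun i => (u i).toNat + (v i).toNat with hw
  have hPsucc (i : ZMod n) :
      P (i + 1) = potential (v (i - 2)) (v (i - 1)) (u i) (v i) (u (i + 1)) (v (i + 1)) := by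
    simp only [hP, add_sub_cancel_right, show i + 1 - 3 = i - 2 by ring,
      show i + 1 - 2 = i - 1 by ring]
  have hstep (i : ZMod n) (hi : i ≠ f) : 0 ≤ 5 * (w (i + 1) : ℤ) - 3 + P i - P (i + 1) := by
    have h₁ := hdom.inner (i - 1)
    rw [show i - 1 - 2 = i - 3 by ring, show i - 1 + 2 = i + 1 by ring] at h₁
    have h₂ := hdom.outer hi
    have := potential_step (v (i - 3)) (v (i - 2)) (u (i - 1)) (v (i - 1)) (u i) (v i)
      (u (i + 1)) (v (i + 1)) (by simpa [hu, hv, or_assoc] using h₁)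
      (by simpa [hu, hv, or_assoc] using h₂)
    rw [hPsucc]
    simp only [hP, hw]
    push_cast
    linarith
  have hexc : -3 ≤ 5 * (w (f + 1) : ℤ) - 3 + P f - P (f + 1) := by
    have hcast (k : ℕ) (h0 : 0 < k) (hk : k < n) : (k : ZMod n) ≠ 0 := fun h =>
      absurd (Nat.le_of_dvd h0 ((ZMod.natCast_eq_zero_iff k n).1 h)) (by omega)
    have hnot (x : PVert n) (hx : x ∈ Nbr n f) : x ∉ S := fun h =>
      (Set.eq_empty_iff_forall_notMem.1 hN x) ⟨hx, h⟩
    have hv1 : vV (f + 1) ∈ S := by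
      have : vV (f + 1) ∈ Blk n f ∩ S := by rw [hB]; simp
      exact this.2
    have hinner (k : ℕ) (hk : vV (f - (k : ZMod n)) ∈ Blk n f) (hk0 : 0 < k) (hk2 : k ≤ 2) :
        vV (f - (k : ZMod n)) ∉ S := by
      intro h
      have hmem : vV (f - (k : ZMod n)) ∈ Blk n f ∩ S := ⟨hk, h⟩
      rw [hB] at hmem
      simp only [uV, vV, Set.mem_insert_iff, Set.mem_singleton_iff, reduceCtorEq, false_or,
        Sum.inr.injEq] at hmem
      rcases hmem with h | h
      · exact hcast (k + 1) (by omega) (by omega) (by push_cast; linear_combination -h)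
      · exact hcast (k + 2) (by omega) (by omega) (by push_cast; linear_combination -h)
    have hvm1 : vV (f - 1) ∉ S := by simpa using hinner 1 (by simp [Blk]) (by simp) (by simp)
    have hvm2 : vV (f - 2) ∉ S := by simpa using hinner 2 (by simp [Blk]) (by simp) (by simp)
    have hvf : vV f ∉ S := hnot _ (by simp [Nbr])
    have hum1 : uV (f - 1) ∉ S := hnot _ (by simp [Nbr])
    have hup1 : uV (f + 1) ∉ S := hnot _ (by simp [Nbr])
    have h := potential_empty_ge (v (f - 3))
    have h0 : potential false false false false false true = 0 := by decide
    rw [hPsucc]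
    simp only [hP, hw]
    simp only [hu, hv, hvm1, hvm2, hvf, hum1, hup1, hv1, hdom.1, decide_false, decide_true,
      Bool.toNat_false, Bool.toNat_true, h0] at h ⊢
    push_cast
    linarith
  have hsum := le_sum_of_nonneg_of_ne _ f hexc hstep
  have hcard : ∑ i, (w (i + 1) : ℤ) = S.ncard := by
    rw [ncard_eq_sum_columns, Nat.cast_sum]
    exact Equiv.sum_comp (Equiv.addRight (1 : ZMod n)) fun i => (w i : ℤ)
  have hshift : ∑ i, P (i + 1) = ∑ i, P i := Equiv.sum_comp (Equiv.addRight (1 : ZMod n)) P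
  simp only [Finset.sum_sub_distrib, Finset.sum_add_distrib, ← Finset.mul_sum, hcard, hshift,
    Finset.sum_const, Finset.card_univ, ZMod.card, nsmul_eq_mul] at hsum
  omega

/-- for `n ≡ 0` or `3 (mod 5)`, every Type II set has
cardinality at least `⌈3n/5⌉`. -/
theorem typeII_lower_bound_mod03 (n : ℕ) (hn : 11 ≤ n)
    (hmod : n % 5 = 0 ∨ n % 5 = 3) (f : ZMod n) (S : Set (PVert n))
    (hS : TypeII n f S) :
    ceil35 n ≤ S.ncard := by
  have h := hS.three_mul_le (by omega)
  have h' : 3 * n ≤ 5 * S.ncard := by omega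
  rw [ceil35, Nat.ceil_le, div_le_iff₀ (by norm_num)]
  exact_mod_cast h'.trans_eq (mul_comm _ _)

end PetersenDom
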